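/- arXiv:math-ph/0605039 — 5 statements merged into one kernel-verified Lean document; each statement's English description precedes it below -/
import Mathlib

section
/- The map (x, p) ↦ x* p x defines a transitive left action of GL₂(H) on P (in particular, every p ∈ P can be written as p = x* x for some x ∈ GL₂(H)), and this action is isometric for the Riemannian metric g_p(U, V) = Tr(p⁻¹ U p⁻¹ V): for every x ∈ GL₂(H), every p ∈ P and all U, V ∈ S₂(H), one has Tr((x* p x)⁻¹ (x* U x) (x* p x)⁻¹ (x* V x)) = Tr(p⁻¹ U p⁻¹ V). -/
noncomputable section

open scoped InnerProductSpace

variable {H : Type*} [NormedAddCommGroup H] [InnerProductSpace ℂ H] [CompleteSpace H]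
variable {ι : Type*}

/-- `A` is a Hilbert–Schmidt operator (w.r.t. the Hilbert basis `e`). -/
def IsHS (e : HilbertBasis ι ℂ H) (A : H →L[ℂ] H) : Prop :=
  Summable fun i => ‖A (e i)‖ ^ 2

/-- The Hilbert–Schmidt norm of `A` (w.r.t. the Hilbert basis `e`). -/
def hsNorm (e : HilbertBasis ι ℂ H) (A : H →L[ℂ] H) : ℝ :=
  Real.sqrt (∑' i, ‖A (e i)‖ ^ 2)

/-- The real Hilbert–Schmidt inner product `⟨A, B⟩₂ = ∑ ⟪A eᵢ, B eᵢ⟫`. -/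
def hsInner (e : HilbertBasis ι ℂ H) (A B : H →L[ℂ] H) : ℝ :=
  (∑' i, (inner ℂ (A (e i)) (B (e i)) : ℂ)).re

/-- The trace of an operator, `Tr T = ∑ ⟪eᵢ, T eᵢ⟫`. -/
def opTrace (e : HilbertBasis ι ℂ H) (T : H →L[ℂ] H) : ℂ :=
  ∑' i, (inner ℂ (e i) (T (e i)) : ℂ)

/-- `T` is trace class: it is the product of two Hilbert–Schmidt operators. -/
def IsTraceClass (e : HilbertBasis ι ℂ H) (T : H →L[ℂ] H) : Prop :=
  ∃ B C : H →L[ℂ] H, IsHS e B ∧ IsHS e C ∧ T = B * C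

/-- `A ∈ S₂(H)`: self-adjoint and Hilbert–Schmidt. -/
def MemS2 (e : HilbertBasis ι ℂ H) (A : H →L[ℂ] H) : Prop :=
  IsSelfAdjoint A ∧ IsHS e A

/-- `p ∈ P`: self-adjoint, positive definite (invertible and `⟪p x, x⟫ ≥ 0`),
with `p - 1` Hilbert–Schmidt. -/
def MemP (e : HilbertBasis ι ℂ H) (p : H →L[ℂ] H) : Prop :=
  IsSelfAdjoint p ∧ IsUnit p ∧ (∀ x : H, 0 ≤ (inner ℂ (p x) x : ℂ).re) ∧ IsHS e (p - 1)

/-- `x ∈ GL₂(H)`: invertible with `x - 1` Hilbert–Schmidt. -/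
def MemGL2 (e : HilbertBasis ι ℂ H) (x : H →L[ℂ] H) : Prop :=
  IsUnit x ∧ IsHS e (x - 1)

/-- `x ∈ U₂(H)`: unitary with `x - 1` Hilbert–Schmidt. -/
def MemU2 (e : HilbertBasis ι ℂ H) (x : H →L[ℂ] H) : Prop :=
  x ∈ unitary (H →L[ℂ] H) ∧ IsHS e (x - 1)

/-- `p^{1/2}`, via continuous functional calculus. -/
def psqrt (p : H →L[ℂ] H) : H →L[ℂ] H := cfc Real.sqrt p

/-- `p^{-1/2}`, via continuous functional calculus. -/
def pinvsqrt (p : H →L[ℂ] H) : H →L[ℂ] H := cfc (fun t : ℝ => (Real.sqrt t)⁻¹) p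

/-- `log p`, via continuous functional calculus. -/
def plog (p : H →L[ℂ] H) : H →L[ℂ] H := cfc Real.log p

/-- The geodesic distance `d(p, q) = ‖log (p^{-1/2} q p^{-1/2})‖₂`. -/
def gdist (e : HilbertBasis ι ℂ H) (p q : H →L[ℂ] H) : ℝ :=
  hsNorm e (plog (pinvsqrt p * q * pinvsqrt p))

/-- The commutator `[A, B] = AB - BA`. -/
def brk (A B : H →L[ℂ] H) : H →L[ℂ] H := A * B - B * A

/-- The constant-speed geodesic `t ↦ p^{1/2} exp(t K) p^{1/2}`. -/
def geoCurve (p K : H →L[ℂ] H) (t : ℝ) : H →L[ℂ] H :=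
  psqrt p * NormedSpace.exp (t • K) * psqrt p

/-- The geodesic from `p` to `q`:
`t ↦ p^{1/2} exp(t log(p^{-1/2} q p^{-1/2})) p^{1/2}`. -/
def geodesic (p q : H →L[ℂ] H) (t : ℝ) : H →L[ℂ] H :=
  geoCurve p (plog (pinvsqrt p * q * pinvsqrt p)) t

/-- The image `exp E` of a set of operators under the exponential map. -/
def expSet (E : Set (H →L[ℂ] H)) : Set (H →L[ℂ] H) := NormedSpace.exp '' E

/-- The orthogonal complement of `E` inside `S₂(H)` for the Hilbert–Schmidt
inner product. -/
def hsPerp (e : HilbertBasis ι ℂ H) (E : Set (H →L[ℂ] H)) : Set (H →L[ℂ] H) :=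
  {Y | MemS2 e Y ∧ ∀ X ∈ E, hsInner e X Y = 0}

/-- `E` is closed in `S₂(H)` with respect to the Hilbert–Schmidt norm. -/
def IsHSClosed (e : HilbertBasis ι ℂ H) (E : Set (H →L[ℂ] H)) : Prop :=
  ∀ X : H →L[ℂ] H, MemS2 e X → (∀ ε > (0:ℝ), ∃ Y ∈ E, hsNorm e (X - Y) < ε) → X ∈ E

theorem hs_parseval (e : HilbertBasis ι ℂ H) (v : H) :
    HasSum (fun j => ‖(inner ℂ (e j) v : ℂ)‖ ^ 2) (‖v‖ ^ 2) := by
  have h := e.hasSum_inner_mul_inner v v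
  have h2 := Complex.hasSum_re h
  have e1 : ∀ j, ((inner ℂ v (e j) : ℂ) * inner ℂ (e j) v).re = ‖(inner ℂ (e j) v : ℂ)‖ ^ 2 := by
    intro j
    rw [← inner_conj_symm v (e j), mul_comm, Complex.mul_conj, Complex.normSq_eq_norm_sq, Complex.ofReal_re]
  simp only [e1] at h2
  rw [inner_self_eq_norm_sq_to_K] at h2
  convert h2 using 1
  norm_cast

theorem isHS_iff_prod (e : HilbertBasis ι ℂ H) (A : H →L[ℂ] H) :
    IsHS e A ↔ Summable fun q : ι × ι => ‖(inner ℂ (e q.2) (A (e q.1)) : ℂ)‖ ^ 2 := by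
  rw [summable_prod_of_nonneg (fun _ => by positivity)]
  simp only [(hs_parseval e _).tsum_eq]
  exact ⟨fun h => ⟨fun i => (hs_parseval e _).summable, h⟩, fun h => h.2⟩

theorem IsHS.adj {e : HilbertBasis ι ℂ H} {A : H →L[ℂ] H} (h : IsHS e A) :
    IsHS e (ContinuousLinearMap.adjoint A) := by
  rw [isHS_iff_prod] at h ⊢
  have h2 := (Equiv.prodComm ι ι).summable_iff.mpr h
  refine h2.congr fun q => ?_
  simp only [Function.comp, Equiv.prodComm_apply, Prod.fst_swap, Prod.snd_swap]
  rw [ContinuousLinearMap.adjoint_inner_right, ← inner_conj_symm, RCLike.norm_conj]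

theorem IsHS.mul_left {e : HilbertBasis ι ℂ H} {A : H →L[ℂ] H} (h : IsHS e A) (B : H →L[ℂ] H) :
    IsHS e (B * A) := by
  refine Summable.of_nonneg_of_le (fun _ => by positivity) (fun i => ?_)
    (Summable.mul_left (‖B‖ ^ 2) h)
  rw [← mul_pow]
  exact pow_le_pow_left₀ (norm_nonneg _) (B.le_opNorm _) 2

theorem IsHS.mul_right {e : HilbertBasis ι ℂ H} {A : H →L[ℂ] H} (h : IsHS e A) (B : H →L[ℂ] H) :
    IsHS e (A * B) := by
  have h1 := (h.adj.mul_left (ContinuousLinearMap.adjoint B)).adj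
  rw [← ContinuousLinearMap.star_eq_adjoint, ← ContinuousLinearMap.star_eq_adjoint,
    ← ContinuousLinearMap.star_eq_adjoint, ← star_mul, star_star] at h1
  exact h1

theorem IsHS.add' {e : HilbertBasis ι ℂ H} {A B : H →L[ℂ] H} (h : IsHS e A) (h' : IsHS e B) :
    IsHS e (A + B) := by
  refine Summable.of_nonneg_of_le (fun _ => by positivity) (fun i => ?_)
    (Summable.mul_left 2 (Summable.add h h'))
  have := norm_add_le (A (e i)) (B (e i))
  simp only [add_apply]
  nlinarith [norm_nonneg (A (e i)), norm_nonneg (B (e i)), norm_nonneg (A (e i) + B (e i)),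
    sq_nonneg (‖A (e i)‖ - ‖B (e i)‖)]

theorem IsHS.sub' {e : HilbertBasis ι ℂ H} {A B : H →L[ℂ] H} (h : IsHS e A) (h' : IsHS e B) :
    IsHS e (A - B) := by
  have := h.add' (h'.mul_left (-1))
  simpa [sub_eq_add_neg] using this

theorem opTrace_comm {e : HilbertBasis ι ℂ H} {A B : H →L[ℂ] H} (hA : IsHS e A) (hB : IsHS e B) :
    opTrace e (A * B) = opTrace e (B * A) := by
  have key : ∀ A B : H →L[ℂ] H, ∀ i, (inner ℂ (e i) ((A * B) (e i)) : ℂ) =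
      ∑' j, (inner ℂ (e i) (A (e j)) : ℂ) * inner ℂ (e j) (B (e i)) := by
    intro A B i
    have := e.tsum_inner_mul_inner (ContinuousLinearMap.adjoint A (e i)) (B (e i))
    simp only [ContinuousLinearMap.adjoint_inner_left] at this
    exact this.symm
  unfold opTrace
  simp only [key]
  have hs : Summable (Function.uncurry fun i j =>
      (inner ℂ (e i) (A (e j)) : ℂ) * inner ℂ (e j) (B (e i))) := by
    rw [isHS_iff_prod] at hA hB
    have hA' := (Equiv.prodComm ι ι).summable_iff.mpr hA
    refine Summable.of_norm_bounded (hA'.add hB) fun q => ?_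
    simp only [Function.uncurry, Function.comp, Equiv.prodComm_apply, Prod.fst_swap, Prod.snd_swap,
      norm_mul]
    nlinarith [sq_nonneg (‖(inner ℂ (e q.1) (A (e q.2)) : ℂ)‖ - ‖(inner ℂ (e q.2) (B (e q.1)) : ℂ)‖),
      sq_nonneg (‖(inner ℂ (e q.1) (A (e q.2)) : ℂ)‖), sq_nonneg ‖(inner ℂ (e q.2) (B (e q.1)) : ℂ)‖]
  rw [← hs.tsum_comm]
  exact tsum_congr fun i => tsum_congr fun j => mul_comm _ _

theorem MemP.exists_sqrt {e : HilbertBasis ι ℂ H} {p : H →L[ℂ] H} (hp : MemP e p) :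
    ∃ s : H →L[ℂ] H, ContinuousLinearMap.adjoint s = s ∧ s * s = p ∧ MemGL2 e s := by
  obtain ⟨hsa, hu, hpos, hhs⟩ := hp
  have hnn : 0 ≤ p := by
    rw [ContinuousLinearMap.nonneg_iff_isPositive]
    exact ⟨ContinuousLinearMap.isSelfAdjoint_iff_isSymmetric.mp hsa, hpos⟩
  have h1 := CFC.sqrt_mul_sqrt_self p hnn
  have h0 := CFC.sqrt_nonneg p
  generalize CFC.sqrt p = s at h1 h0
  have hsa : IsSelfAdjoint s := IsSelfAdjoint.of_nonneg h0
  refine ⟨s, ?_, h1, ?_, ?_⟩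
  · rw [← ContinuousLinearMap.star_eq_adjoint]; exact hsa
  · rw [← h1] at hu
    exact (Commute.isUnit_mul_iff (Commute.refl s)).mp hu |>.1
  · have hu1 : IsUnit (s + 1) :=
      CStarAlgebra.isUnit_of_le (1 : H →L[ℂ] H) (by simpa using h0) (by simp)
    have : s - 1 = Ring.inverse (s + 1) * (p - 1) := by
      have : p - 1 = (s + 1) * (s - 1) := by rw [← h1]; noncomm_ring
      rw [this, Ring.inverse_mul_cancel_left _ _ hu1]
    rw [this]
    exact hhs.mul_left _

/-- The map `(x, p) ↦ x* p x` is a transitive action of `GL₂(H)`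
on `P` (in particular every `p ∈ P` is of the form `x* x`), and it is isometric for
the Riemannian metric `g_p(U, V) = Tr(p⁻¹ U p⁻¹ V)`. -/
theorem statement0 (e : HilbertBasis ι ℂ H) :
    (∀ x p : H →L[ℂ] H, MemGL2 e x → MemP e p →
      MemP e (ContinuousLinearMap.adjoint x * p * x)) ∧
    (∀ p q : H →L[ℂ] H, MemP e p → MemP e q →
      ∃ x : H →L[ℂ] H, MemGL2 e x ∧ ContinuousLinearMap.adjoint x * p * x = q) ∧
    (∀ p : H →L[ℂ] H, MemP e p →
      ∃ x : H →L[ℂ] H, MemGL2 e x ∧ p = ContinuousLinearMap.adjoint x * x) ∧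
    (∀ x p U V : H →L[ℂ] H, MemGL2 e x → MemP e p → MemS2 e U → MemS2 e V →
      opTrace e (Ring.inverse (ContinuousLinearMap.adjoint x * p * x) *
          (ContinuousLinearMap.adjoint x * U * x) *
          Ring.inverse (ContinuousLinearMap.adjoint x * p * x) *
          (ContinuousLinearMap.adjoint x * V * x)) =
        opTrace e (Ring.inverse p * U * Ring.inverse p * V)) := by
  refine ⟨?_, ?_, ?_, ?_⟩
  · rintro x p ⟨hxu, hx⟩ ⟨hsa, hu, hpos, hhs⟩
    refine ⟨?_, ?_, ?_, ?_⟩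
    · rw [← ContinuousLinearMap.star_eq_adjoint]
      exact hsa.conjugate' x
    · rw [← ContinuousLinearMap.star_eq_adjoint]
      exact (hxu.star.mul hu).mul hxu
    · intro y
      have := hpos (x y)
      simpa [ContinuousLinearMap.adjoint_inner_left] using this
    · have h : ContinuousLinearMap.adjoint x * p * x - 1 =
          ContinuousLinearMap.adjoint x * p * (x - 1) + (ContinuousLinearMap.adjoint x * (p - 1)
            + ContinuousLinearMap.adjoint (x - 1)) := by
        simp only [← ContinuousLinearMap.star_eq_adjoint, star_sub, star_one]
        noncomm_ring
      rw [h]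
      exact (hx.mul_left _).add' ((hhs.mul_left _).add' hx.adj)
  · intro p q hp hq
    obtain ⟨s, hs1, hs2, hsu, hs⟩ := hp.exists_sqrt
    obtain ⟨t, ht1, ht2, htu, ht⟩ := hq.exists_sqrt
    refine ⟨Ring.inverse s * t, ⟨hsu.ringInverse.mul htu, ?_⟩, ?_⟩
    · have h : Ring.inverse s * t - 1 = Ring.inverse s * ((t - 1) - (s - 1)) := by
        have := Ring.inverse_mul_cancel s hsu
        simp only [mul_sub, this]
        noncomm_ring
      rw [h]
      exact (ht.sub' hs).mul_left _
    · have h2 : star (Ring.inverse s) = Ring.inverse s := by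
        rw [← Ring.inverse_star, ContinuousLinearMap.star_eq_adjoint, hs1]
      rw [← ContinuousLinearMap.star_eq_adjoint, star_mul, h2,
        ContinuousLinearMap.star_eq_adjoint, ht1, ← hs2]
      calc t * Ring.inverse s * (s * s) * (Ring.inverse s * t)
          = t * (Ring.inverse s * s) * (s * Ring.inverse s) * t := by noncomm_ring
        _ = q := by
          rw [Ring.inverse_mul_cancel s hsu, Ring.mul_inverse_cancel s hsu, mul_one, mul_one, ht2]
  · intro p hp
    obtain ⟨s, hs1, hs2, hs⟩ := hp.exists_sqrt
    exact ⟨s, hs, by rw [hs1, hs2]⟩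
  · rintro x p U V ⟨hxu, hx⟩ ⟨hsa, hu, hpos, hhs⟩ ⟨-, hU⟩ ⟨-, hV⟩
    rw [← ContinuousLinearMap.star_eq_adjoint]
    have hsu : IsUnit (star x) := hxu.star
    have hinv : Ring.inverse (star x * p * x) =
        Ring.inverse x * Ring.inverse p * Ring.inverse (star x) := by
      rw [Ring.inverse_mul (Or.inr hxu), Ring.inverse_mul (Or.inl hsu), mul_assoc]
    have c1 := Ring.inverse_mul_cancel _ hsu
    have c2 := Ring.mul_inverse_cancel _ hxu
    have hBC : Ring.inverse (star x * p * x) * (star x * U * x) *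
          Ring.inverse (star x * p * x) * (star x * V * x) =
        (Ring.inverse x * (Ring.inverse p * U)) * ((Ring.inverse p * V) * x) := by
      rw [hinv]
      calc _ = Ring.inverse x * Ring.inverse p * (Ring.inverse (star x) * star x) * U *
            (x * Ring.inverse x) * Ring.inverse p * (Ring.inverse (star x) * star x) * V * x := by
            simp only [mul_assoc]
        _ = _ := by rw [c1, c2]; simp only [mul_assoc, mul_one, one_mul]
    have hB : IsHS e (Ring.inverse p * U) := hU.mul_left _
    have hC : IsHS e (Ring.inverse p * V) := hV.mul_left _
    rw [hBC, opTrace_comm (hB.mul_left _) (hC.mul_right _)]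
    have h3 : Ring.inverse p * V * x * (Ring.inverse x * (Ring.inverse p * U)) =
        (Ring.inverse p * V) * (Ring.inverse p * U) := by
      calc _ = Ring.inverse p * V * (x * Ring.inverse x) * (Ring.inverse p * U) := by
            simp only [mul_assoc]
        _ = _ := by rw [c2, mul_one]
    rw [h3, opTrace_comm hC hB]
    simp only [mul_assoc]
end
end

section
/- For all X, Y ∈ S₂(H), the product [[X,Y],X]·Y is trace class and Tr([[X,Y],X]·Y) = −Tr([X,Y]*·[X,Y]) = −‖[X,Y]‖₂² ≤ 0. (This quantity is the numerator g([[X,Y],X],Y) of the sectional curvature of P at the identity, so P has non-positive sectional curvature.) -/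
noncomputable section

open scoped InnerProductSpace

variable {H : Type*} [NormedAddCommGroup H] [InnerProductSpace ℂ H] [CompleteSpace H]
variable {ι : Type*}

lemma isHS_mul_left (e : HilbertBasis ι ℂ H) (A B : H →L[ℂ] H) (hB : IsHS e B) :
    IsHS e (A * B) := by
  unfold IsHS at *
  refine Summable.of_nonneg_of_le (fun i => by positivity) (fun i => ?_) (hB.mul_left (‖A‖ ^ 2))
  rw [← mul_pow]
  gcongr
  exact A.le_opNorm _

lemma isHS_sub (e : HilbertBasis ι ℂ H) (A B : H →L[ℂ] H) (hA : IsHS e A) (hB : IsHS e B) :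
    IsHS e (A - B) := by
  unfold IsHS at *
  refine Summable.of_nonneg_of_le (fun i => by positivity) (fun i => ?_)
    ((hA.add hB).mul_left 2)
  have h : ‖(A - B) (e i)‖ ≤ ‖A (e i)‖ + ‖B (e i)‖ := norm_sub_le _ _
  nlinarith [norm_nonneg ((A - B) (e i)), sq_nonneg (‖A (e i)‖ - ‖B (e i)‖),
    norm_nonneg (A (e i)), norm_nonneg (B (e i))]

lemma hasSum_norm_inner (e : HilbertBasis ι ℂ H) (x : H) :
    HasSum (fun j => ‖(inner ℂ (e j) x : ℂ)‖ ^ 2) (‖x‖ ^ 2) := by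
  have h := e.hasSum_inner_mul_inner x x
  have h2 := Complex.hasSum_re h
  convert h2 using 1
  · funext j
    rw [← inner_conj_symm x (e j), RCLike.conj_mul]
    norm_cast
  · rw [inner_self_eq_norm_sq_to_K]
    norm_cast

lemma summable_coeff (e : HilbertBasis ι ℂ H) (A : H →L[ℂ] H) (hA : IsHS e A) :
    Summable (fun p : ι × ι => ‖(inner ℂ (e p.2) (A (e p.1)) : ℂ)‖ ^ 2) := by
  rw [summable_prod_of_nonneg (fun p => by positivity)]
  refine ⟨fun i => (hasSum_norm_inner e (A (e i))).summable, ?_⟩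
  simp only [(hasSum_norm_inner e _).tsum_eq]
  exact hA

def dblSum (e : HilbertBasis ι ℂ H) (A B : H →L[ℂ] H) : ℂ :=
  ∑' p : ι × ι, (inner ℂ (e p.1) (A (e p.2)) : ℂ) * (inner ℂ (e p.2) (B (e p.1)) : ℂ)

lemma dblSum_comm (e : HilbertBasis ι ℂ H) (A B : H →L[ℂ] H) :
    dblSum e A B = dblSum e B A := by
  unfold dblSum
  rw [← (Equiv.prodComm ι ι).tsum_eq]
  refine tsum_congr fun p => ?_
  simp [mul_comm]

lemma hasSum_trace (e : HilbertBasis ι ℂ H) (A B : H →L[ℂ] H) (hA : IsHS e A)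
    (hB : IsHS e B) :
    HasSum (fun i => (inner ℂ (e i) ((A * B) (e i)) : ℂ)) (dblSum e A B) := by
  have hs : Summable (fun p : ι × ι =>
      (inner ℂ (e p.1) (A (e p.2)) : ℂ) * (inner ℂ (e p.2) (B (e p.1)) : ℂ)) := by
    have h1 := (Equiv.prodComm ι ι).summable_iff.mpr (summable_coeff e A hA)
    refine Summable.of_norm_bounded (h1.add (summable_coeff e B hB)) fun p => ?_
    simp only [Function.comp_apply, Equiv.prodComm_apply, Prod.fst_swap, Prod.snd_swap, norm_mul]
    nlinarith [sq_nonneg (‖(inner ℂ (e p.1) (A (e p.2)) : ℂ)‖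
      - ‖(inner ℂ (e p.2) (B (e p.1)) : ℂ)‖),
      sq_nonneg ‖(inner ℂ (e p.1) (A (e p.2)) : ℂ)‖,
      sq_nonneg ‖(inner ℂ (e p.2) (B (e p.1)) : ℂ)‖]
  refine hs.hasSum.prod_fiberwise fun i => ?_
  have h := e.hasSum_inner_mul_inner (ContinuousLinearMap.adjoint A (e i)) (B (e i))
  simp only [ContinuousLinearMap.adjoint_inner_left] at h
  exact h

/-- For `X, Y ∈ S₂(H)`, the operator `[[X,Y],X]·Y` is trace class and
`Tr([[X,Y],X]·Y) = −Tr([X,Y]*[X,Y]) = −‖[X,Y]‖₂² ≤ 0`. -/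
theorem statement1 (e : HilbertBasis ι ℂ H) (X Y : H →L[ℂ] H)
    (hX : MemS2 e X) (hY : MemS2 e Y) :
    IsTraceClass e (brk (brk X Y) X * Y) ∧
    opTrace e (brk (brk X Y) X * Y) =
      - opTrace e (ContinuousLinearMap.adjoint (brk X Y) * brk X Y) ∧
    opTrace e (brk (brk X Y) X * Y) = -((hsNorm e (brk X Y) ^ 2 : ℝ) : ℂ) ∧
    (opTrace e (brk (brk X Y) X * Y)).re ≤ 0 := by
  obtain ⟨hXs, hX⟩ := hX
  obtain ⟨hYs, hY⟩ := hY
  have hC : IsHS e (brk X Y) :=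
    isHS_sub e _ _ (isHS_mul_left e _ _ hY) (isHS_mul_left e _ _ hX)
  have hadj : ContinuousLinearMap.adjoint (brk X Y) = - brk X Y := by
    rw [← ContinuousLinearMap.star_eq_adjoint, brk, star_sub, star_mul, star_mul,
      hXs.star_eq, hYs.star_eq, neg_sub]
  have h1 := hasSum_trace e (brk X Y * X) Y (isHS_mul_left e _ _ hX) hY
  have h2 := hasSum_trace e X (brk X Y * Y) hX (isHS_mul_left e _ _ hY)
  have h3 := hasSum_trace e (brk X Y * Y) X (isHS_mul_left e _ _ hY) hX
  rw [dblSum_comm] at h3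
  have hL : opTrace e (brk (brk X Y) X * Y) =
      dblSum e (brk X Y * X) Y - dblSum e X (brk X Y * Y) := by
    have h := h1.sub h2
    refine Eq.trans ?_ h.tsum_eq
    refine tsum_congr fun i => ?_
    rw [← inner_sub_right, ← ContinuousLinearMap.sub_apply]
    congr 3
  have hR : opTrace e (ContinuousLinearMap.adjoint (brk X Y) * brk X Y) =
      - (dblSum e (brk X Y * X) Y - dblSum e X (brk X Y * Y)) := by
    have h := (h1.sub h3).neg
    refine Eq.trans ?_ h.tsum_eq
    refine tsum_congr fun i => ?_
    rw [hadj, ← inner_sub_right, ← ContinuousLinearMap.sub_apply, ← inner_neg_right,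
      ← ContinuousLinearMap.neg_apply]
    congr 3
    simp only [brk]; noncomm_ring
  have hN : opTrace e (ContinuousLinearMap.adjoint (brk X Y) * brk X Y) =
      ((hsNorm e (brk X Y) ^ 2 : ℝ) : ℂ) := by
    rw [hsNorm, Real.sq_sqrt (tsum_nonneg fun i => by positivity), Complex.ofReal_tsum]
    refine tsum_congr fun i => ?_
    rw [ContinuousLinearMap.mul_apply, ContinuousLinearMap.adjoint_inner_right,
      inner_self_eq_norm_sq_to_K]
    norm_cast
  have hE : opTrace e (brk (brk X Y) X * Y) =
      - opTrace e (ContinuousLinearMap.adjoint (brk X Y) * brk X Y) := by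
    rw [hL, hR, neg_neg]
  refine ⟨⟨brk (brk X Y) X, Y, ?_, hY, rfl⟩, hE, by rw [hE, hN], ?_⟩
  · exact isHS_sub e _ _ (isHS_mul_left e _ _ hX) (isHS_mul_left e _ _ hC)
  · rw [hE, hN, ← Complex.ofReal_neg, Complex.ofReal_re]
    exact neg_nonpos.mpr (sq_nonneg _)
end
end

section
/- Let A be a unital Banach algebra over ℝ or ℂ and let X ∈ A. Then the exponential map is Fréchet differentiable at X and its differential is given by d_X exp (Y) = exp(X) · (∑_{n=0}^∞ (−1)ⁿ/(n+1)! · (ad X)ⁿ(Y)) for all Y ∈ A; that is, d_X exp = L_{exp(X)} ∘ ((1 − e^{−ad X})/ad X), where the operator series converges absolutely in operator norm. -/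
noncomputable section

/-- The homogeneous sum `∑ L^i R^(n-i)`, defined recursively. -/
def geomG {B : Type*} [Ring B] (L R : B) : ℕ → B
  | 0 => 1
  | n + 1 => L * geomG L R n + R ^ (n + 1)

lemma geomG_eq {B : Type*} [Ring B] {L R : B} (h : Commute L R) (n : ℕ) :
    geomG L R n = ∑ k ∈ Finset.range (n + 1),
      ((n + 1).choose k) • (L ^ k * (R - L) ^ (n - k)) := by
  induction n with
  | zero => simp [geomG]
  | succ n ih =>
    have hc : Commute L (R - L) := h.sub_right (Commute.refl L)
    have hR : R ^ (n + 1) = (L + (R - L)) ^ (n + 1) := by congr 1; abel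
    rw [geomG, ih, hR, hc.add_pow, Finset.sum_range_succ' _ (n + 1),
      Finset.sum_range_succ' _ (n + 1), Finset.mul_sum, ← add_assoc, ← Finset.sum_add_distrib]
    congr 1
    · refine Finset.sum_congr rfl fun k hk => ?_
      rw [Nat.choose_succ_succ (n + 1) k, Nat.add_sub_add_right, add_smul, mul_smul_comm,
        ← mul_assoc, ← pow_succ', ← nsmul_eq_mul']
    · simp

lemma clm_norm_pow_le {𝕜 E : Type*} [RCLike 𝕜] [NormedAddCommGroup E] [NormedSpace 𝕜 E]
    (T : E →L[𝕜] E) (n : ℕ) : ‖T ^ n‖ ≤ ‖T‖ ^ n := by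
  induction n with
  | zero => simpa using! ContinuousLinearMap.norm_id_le (𝕜 := 𝕜) (E := E)
  | succ n ih =>
    rw [pow_succ, pow_succ]
    exact (norm_mul_le _ _).trans (by gcongr)

lemma clm_norm_geomG_le {𝕜 E : Type*} [RCLike 𝕜] [NormedAddCommGroup E] [NormedSpace 𝕜 E]
    (L R : E →L[𝕜] E) (r : ℝ) (hL : ‖L‖ ≤ r) (hR : ‖R‖ ≤ r) (n : ℕ) :
    ‖geomG L R n‖ ≤ (n + 1) * r ^ n := by
  have hr : 0 ≤ r := (norm_nonneg _).trans hL
  induction n with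
  | zero => simpa [geomG] using! ContinuousLinearMap.norm_id_le (𝕜 := 𝕜) (E := E)
  | succ n ih =>
    rw [geomG]
    calc _ ≤ ‖L‖ * ‖geomG L R n‖ + ‖R‖ ^ (n + 1) :=
          (norm_add_le _ _).trans (add_le_add (norm_mul_le _ _) (clm_norm_pow_le _ _))
      _ ≤ r * ((n + 1) * r ^ n) + r ^ (n + 1) := by gcongr
      _ = _ := by push_cast; ring

section

variable {𝕜 : Type*} [RCLike 𝕜] {A : Type*} [NormedRing A] [NormedAlgebra 𝕜 A]

lemma mul_pow_clm (X : A) (n : ℕ) :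
    (ContinuousLinearMap.mul 𝕜 A X) ^ n = ContinuousLinearMap.mul 𝕜 A (X ^ n) := by
  induction n with
  | zero => ext; simp
  | succ n ih => rw [pow_succ, ih]; ext Y; simp [pow_succ, mul_assoc]

lemma flip_pow_clm (X : A) (n : ℕ) (Y : A) :
    ((ContinuousLinearMap.mul 𝕜 A).flip X ^ n) Y = Y * X ^ n := by
  induction n generalizing Y with
  | zero => simp
  | succ n ih => rw [pow_succ]; simp [ih, pow_succ', mul_assoc]

lemma add_apply_clm (S T : A →L[𝕜] A) (Y : A) : (S + T) Y = S Y + T Y := rfl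

lemma hasFDerivAt_pow_geomG (X : A) (n : ℕ) :
    HasFDerivAt (fun y : A => y ^ (n + 1))
      (geomG (ContinuousLinearMap.mul 𝕜 A X) ((ContinuousLinearMap.mul 𝕜 A).flip X) n) X := by
  induction n with
  | zero => simpa [geomG] using! hasFDerivAt_id (𝕜 := 𝕜) X
  | succ n ih =>
    have h := (hasFDerivAt_id (𝕜 := 𝕜) X).mul' ih
    have e : (fun y : A => y ^ (n + 1 + 1)) = (id * fun y : A => y ^ (n + 1)) := by
      funext y; simp [pow_succ' y (n + 1)]
    rw [e]
    refine h.congr_fderiv ?_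
    ext Y
    have h2 := flip_pow_clm (𝕜 := 𝕜) X (n + 1) Y
    rw [geomG, add_apply_clm, add_apply_clm, h2]
    simp

lemma norm_flip_le (X : A) : ‖(ContinuousLinearMap.mul 𝕜 A).flip X‖ ≤ ‖X‖ :=
  ContinuousLinearMap.opNorm_le_bound _ (norm_nonneg _)
    fun Y => by simpa [mul_comm] using norm_mul_le Y X

lemma bound_geomG (y : A) (r : ℝ) (hy : ‖y‖ ≤ r) (n : ℕ) :
    ‖(Nat.factorial (n + 1) : 𝕜)⁻¹ •
      geomG (ContinuousLinearMap.mul 𝕜 A y) ((ContinuousLinearMap.mul 𝕜 A).flip y) n‖ ≤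
      r ^ n / (Nat.factorial n : ℝ) := by
  have h := clm_norm_geomG_le (𝕜 := 𝕜) (ContinuousLinearMap.mul 𝕜 A y)
    ((ContinuousLinearMap.mul 𝕜 A).flip y) r
    ((ContinuousLinearMap.opNorm_mul_apply_le _ _ _).trans hy) ((norm_flip_le y).trans hy) n
  rw [norm_smul, norm_inv, RCLike.norm_natCast]
  calc _ ≤ ((Nat.factorial (n + 1) : ℝ))⁻¹ * ((n + 1) * r ^ n) :=
        mul_le_mul_of_nonneg_left h (by positivity)
    _ = _ := by
        have h2 : (Nat.factorial n : ℝ) ≠ 0 := Nat.cast_ne_zero.mpr (Nat.factorial_ne_zero _)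
        have h3 : (n + 1 : ℝ) ≠ 0 := by positivity
        rw [Nat.factorial_succ]
        push_cast
        field_simp

lemma cauchy_term (X : A) (n : ℕ) :
    ∑ k ∈ Finset.range (n + 1), ((Nat.factorial k : 𝕜)⁻¹ • (ContinuousLinearMap.mul 𝕜 A X) ^ k) *
      (((-1 : 𝕜) ^ (n - k) / (Nat.factorial (n - k + 1) : 𝕜)) •
        (ContinuousLinearMap.mul 𝕜 A X - (ContinuousLinearMap.mul 𝕜 A).flip X) ^ (n - k)) =
    (Nat.factorial (n + 1) : 𝕜)⁻¹ •
      geomG (ContinuousLinearMap.mul 𝕜 A X) ((ContinuousLinearMap.mul 𝕜 A).flip X) n := by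
  have hc : Commute (ContinuousLinearMap.mul 𝕜 A X) ((ContinuousLinearMap.mul 𝕜 A).flip X) := by
    ext Y; simp [mul_assoc]
  rw [geomG_eq hc, Finset.smul_sum]
  refine Finset.sum_congr rfl fun k hk => ?_
  have hk' : k ≤ n := Nat.lt_succ_iff.mp (Finset.mem_range.mp hk)
  have hneg : (ContinuousLinearMap.mul 𝕜 A).flip X - ContinuousLinearMap.mul 𝕜 A X =
      (-1 : 𝕜) • (ContinuousLinearMap.mul 𝕜 A X - (ContinuousLinearMap.mul 𝕜 A).flip X) := by
    rw [neg_one_smul]; abel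
  rw [hneg, smul_pow, smul_mul_smul_comm, mul_smul_comm, ← Nat.cast_smul_eq_nsmul 𝕜, smul_smul,
    smul_smul]
  congr 1
  rw [Nat.cast_choose 𝕜 (by omega : k ≤ n + 1), show n + 1 - k = n - k + 1 by omega]
  have h1 : (Nat.factorial (n + 1) : 𝕜) ≠ 0 := Nat.cast_ne_zero.mpr (Nat.factorial_ne_zero _)
  have h2 : (Nat.factorial k : 𝕜) ≠ 0 := Nat.cast_ne_zero.mpr (Nat.factorial_ne_zero _)
  have h3 : (Nat.factorial (n - k + 1) : 𝕜) ≠ 0 := Nat.cast_ne_zero.mpr (Nat.factorial_ne_zero _)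
  field_simp

lemma summable_ad_op (T : A →L[𝕜] A) :
    Summable (fun n : ℕ => ‖((-1 : 𝕜) ^ n / (Nat.factorial (n + 1) : 𝕜)) • T ^ n‖) := by
  refine Summable.of_nonneg_of_le (fun _ => norm_nonneg _) (fun n => ?_)
    (Real.summable_pow_div_factorial ‖T‖)
  rw [norm_smul, norm_div, norm_pow, norm_neg, norm_one, one_pow, RCLike.norm_natCast,
    one_div, div_eq_inv_mul]
  gcongr
  · exact Nat.le_succ n
  · exact clm_norm_pow_le T n

variable [CompleteSpace A]

lemma hasFDerivAt_exp_geomG (X : A) :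
    HasFDerivAt NormedSpace.exp (∑' n : ℕ, (Nat.factorial (n + 1) : 𝕜)⁻¹ •
      geomG (ContinuousLinearMap.mul 𝕜 A X) ((ContinuousLinearMap.mul 𝕜 A).flip X) n) X := by
  let _ : NormedSpace ℝ A := NormedSpace.restrictScalars ℝ 𝕜 A
  let _ : NormedAlgebra ℚ A := NormedAlgebra.restrictScalars ℚ 𝕜 A
  have hs : ∀ y : A, Summable fun n : ℕ => (Nat.factorial n : 𝕜)⁻¹ • y ^ n :=
    fun y => NormedSpace.expSeries_summable' y
  have hexp : (NormedSpace.exp : A → A) =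
      fun y => 1 + ∑' n : ℕ, (Nat.factorial (n + 1) : 𝕜)⁻¹ • y ^ (n + 1) := by
    rw [NormedSpace.exp_eq_tsum 𝕜]
    funext y
    rw [(hs y).tsum_eq_zero_add]
    simp
  rw [hexp]
  refine HasFDerivAt.const_add _ ?_
  have hX : X ∈ Metric.ball (0 : A) (‖X‖ + 1) := by simp
  refine hasFDerivAt_tsum_of_isPreconnected (𝕜 := 𝕜) (x₀ := X)
    (f := fun (n : ℕ) (y : A) => (Nat.factorial (n + 1) : 𝕜)⁻¹ • y ^ (n + 1))
    (f' := fun (n : ℕ) (y : A) => (Nat.factorial (n + 1) : 𝕜)⁻¹ •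
      geomG (ContinuousLinearMap.mul 𝕜 A y) ((ContinuousLinearMap.mul 𝕜 A).flip y) n)
    (Real.summable_pow_div_factorial (‖X‖ + 1))
    Metric.isOpen_ball (convex_ball (0 : A) (‖X‖ + 1)).isPreconnected ?_ ?_ hX ?_ hX
  · intro n y _
    exact (hasFDerivAt_pow_geomG (𝕜 := 𝕜) y n).const_smul ((Nat.factorial (n + 1) : 𝕜)⁻¹)
  · intro n y hy
    exact bound_geomG y _ (by simpa using (Metric.mem_ball.mp hy).le) n
  · exact (summable_nat_add_iff (f := fun n : ℕ => (Nat.factorial n : 𝕜)⁻¹ • X ^ n) 1).mpr (hs X)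

end


/-- In a unital Banach algebra over `ℝ` or `ℂ`, the exponential map is
Fréchet differentiable at every `X`, with differential
`Y ↦ exp X · (∑ (−1)ⁿ/(n+1)! (ad X)ⁿ Y)`, the operator series converging absolutely
in operator norm. -/
theorem statement2 (𝕜 : Type*) [RCLike 𝕜] (A : Type*) [NormedRing A] [NormedAlgebra 𝕜 A]
    [CompleteSpace A] (X : A) :
    Summable (fun n : ℕ => ‖((-1 : 𝕜) ^ n / (Nat.factorial (n + 1) : 𝕜)) •
        (ContinuousLinearMap.mul 𝕜 A X - (ContinuousLinearMap.mul 𝕜 A).flip X) ^ n‖) ∧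
    HasFDerivAt NormedSpace.exp
      ((ContinuousLinearMap.mul 𝕜 A (NormedSpace.exp X)).comp
        (∑' n : ℕ, ((-1 : 𝕜) ^ n / (Nat.factorial (n + 1) : 𝕜)) •
          (ContinuousLinearMap.mul 𝕜 A X - (ContinuousLinearMap.mul 𝕜 A).flip X) ^ n)) X := by
  let _ : NormedAlgebra ℚ A := NormedAlgebra.restrictScalars ℚ 𝕜 A
  have hsum := summable_ad_op (𝕜 := 𝕜)
    (ContinuousLinearMap.mul 𝕜 A X - (ContinuousLinearMap.mul 𝕜 A).flip X)
  refine ⟨hsum, (hasFDerivAt_exp_geomG (𝕜 := 𝕜) X).congr_fderiv ?_⟩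
  have hL : Summable fun n : ℕ =>
      ‖(Nat.factorial n : 𝕜)⁻¹ • (ContinuousLinearMap.mul 𝕜 A X) ^ n‖ :=
    NormedSpace.norm_expSeries_summable' _
  have hE : ContinuousLinearMap.mul 𝕜 A (NormedSpace.exp X) =
      ∑' n : ℕ, (Nat.factorial n : 𝕜)⁻¹ • (ContinuousLinearMap.mul 𝕜 A X) ^ n := by
    have h := (NormedSpace.exp_series_hasSum_exp' (𝕂 := 𝕜) X).mapL (ContinuousLinearMap.mul 𝕜 A)
    rw [← h.tsum_eq]
    refine tsum_congr fun n => ?_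
    rw [map_smul, mul_pow_clm]
  rw [hE]
  have hP := tsum_mul_tsum_eq_tsum_sum_range_of_summable_norm hL hsum
  simp only [cauchy_term] at hP
  exact hP.symm
end
end

section
/- The exponential map exp(A) = ∑_{n≥0} Aⁿ/n! is a bijection from S₂(H) onto P, with inverse p ↦ log p, and it is a homeomorphism when S₂(H) carries its Hilbert–Schmidt norm and P carries the metric (p, q) ↦ ‖p − q‖₂. -/
noncomputable section

open scoped InnerProductSpace

variable {H : Type*} [NormedAddCommGroup H] [InnerProductSpace ℂ H] [CompleteSpace H]
variable {ι : Type*}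

theorem le_of_sq_le_sq_aux {a b : ℝ} (h : a ^ 2 ≤ b ^ 2) (hb : 0 ≤ b) : a ≤ b :=
  (le_abs_self a).trans (abs_le_of_sq_le_sq h hb)

/-! ### Hilbert–Schmidt preliminaries -/

theorem aux_enorm_sq_eq (e : HilbertBasis ι ℂ H) (x : H) :
    ENNReal.ofReal (‖x‖ ^ 2) = ∑' j, ENNReal.ofReal (‖(inner ℂ (e j) x : ℂ)‖ ^ 2) := by
  have h := e.hasSum_inner_mul_inner x x
  have h2 : HasSum (fun j => ‖(inner ℂ (e j) x : ℂ)‖ ^ 2) (‖x‖ ^ 2) := by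
    have h3 := Complex.hasSum_re h
    have h4 : (inner ℂ x x : ℂ).re = ‖x‖ ^ 2 := by
      rw [inner_self_eq_norm_sq_to_K]; norm_cast
    rw [h4] at h3
    refine h3.congr_fun ?_ |> id
    intro j
    rw [← inner_conj_symm x (e j), mul_comm, Complex.mul_conj, Complex.normSq_eq_norm_sq]
    norm_cast
  rw [← h2.tsum_eq, ENNReal.ofReal_tsum_of_nonneg (fun _ => by positivity) h2.summable]

theorem aux_adj (e : HilbertBasis ι ℂ H) (A : H →L[ℂ] H) :
    ∑' i, ENNReal.ofReal (‖(star A) (e i)‖ ^ 2) = ∑' i, ENNReal.ofReal (‖A (e i)‖ ^ 2) := by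
  simp_rw [aux_enorm_sq_eq e ((star A) (e _)), aux_enorm_sq_eq e (A (e _))]
  rw [ENNReal.tsum_comm]
  refine tsum_congr fun i => tsum_congr fun j => ?_
  rw [ContinuousLinearMap.star_eq_adjoint, ContinuousLinearMap.adjoint_inner_right,
    norm_inner_symm]

theorem aux_isHS_iff (e : HilbertBasis ι ℂ H) (A : H →L[ℂ] H) :
    IsHS e A ↔ ∑' i, ENNReal.ofReal (‖A (e i)‖ ^ 2) ≠ ⊤ := by
  unfold IsHS
  constructor
  · intro h
    rw [← ENNReal.ofReal_tsum_of_nonneg (fun _ => by positivity) h]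
    exact ENNReal.ofReal_ne_top
  · intro h
    have := ENNReal.summable_toReal h
    refine this.congr fun i => ?_
    rw [ENNReal.toReal_ofReal (by positivity)]

theorem aux_hsNorm_eq (e : HilbertBasis ι ℂ H) (A : H →L[ℂ] H) :
    hsNorm e A = Real.sqrt (∑' i, ENNReal.ofReal (‖A (e i)‖ ^ 2)).toReal := by
  unfold hsNorm
  rw [ENNReal.tsum_toReal_eq (fun _ => ENNReal.ofReal_ne_top)]
  congr 1
  refine tsum_congr fun i => ?_
  rw [ENNReal.toReal_ofReal (by positivity)]

theorem aux_isHS_star (e : HilbertBasis ι ℂ H) {A : H →L[ℂ] H} (h : IsHS e A) :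
    IsHS e (star A) := by
  rw [aux_isHS_iff, aux_adj, ← aux_isHS_iff]; exact h

theorem aux_hsNorm_star (e : HilbertBasis ι ℂ H) (A : H →L[ℂ] H) :
    hsNorm e (star A) = hsNorm e A := by
  rw [aux_hsNorm_eq, aux_adj, ← aux_hsNorm_eq]

theorem aux_hsNorm_nonneg (e : HilbertBasis ι ℂ H) (A : H →L[ℂ] H) : 0 ≤ hsNorm e A :=
  Real.sqrt_nonneg _

theorem aux_hsNorm_sq (e : HilbertBasis ι ℂ H) (A : H →L[ℂ] H) :
    hsNorm e A ^ 2 = ∑' i, ‖A (e i)‖ ^ 2 :=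
  Real.sq_sqrt (tsum_nonneg fun _ => by positivity)

theorem aux_isHS_left (e : HilbertBasis ι ℂ H) (B : H →L[ℂ] H) {A : H →L[ℂ] H}
    (h : IsHS e A) : IsHS e (B * A) := by
  refine Summable.of_nonneg_of_le (fun _ => by positivity) (fun i => ?_)
    (Summable.mul_left (‖B‖ ^ 2) h)
  rw [← mul_pow]
  gcongr
  exact B.le_opNorm _

theorem aux_hsNorm_left (e : HilbertBasis ι ℂ H) (B : H →L[ℂ] H) {A : H →L[ℂ] H}
    (h : IsHS e A) : hsNorm e (B * A) ≤ ‖B‖ * hsNorm e A := by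
  refine le_of_sq_le_sq_aux ?_ (mul_nonneg (norm_nonneg _) (aux_hsNorm_nonneg e A))
  rw [mul_pow, aux_hsNorm_sq, aux_hsNorm_sq, ← tsum_mul_left]
  refine Summable.tsum_le_tsum (fun i => ?_) (aux_isHS_left e B h) (Summable.mul_left (‖B‖ ^ 2) h)
  rw [← mul_pow]
  gcongr
  exact B.le_opNorm _

theorem aux_isHS_right (e : HilbertBasis ι ℂ H) {A : H →L[ℂ] H} (B : H →L[ℂ] H)
    (h : IsHS e A) : IsHS e (A * B) := by
  have := aux_isHS_star e (aux_isHS_left e (star B) (aux_isHS_star e h))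
  simpa using this

theorem aux_hsNorm_right (e : HilbertBasis ι ℂ H) {A : H →L[ℂ] H} (B : H →L[ℂ] H)
    (h : IsHS e A) : hsNorm e (A * B) ≤ hsNorm e A * ‖B‖ := by
  have := aux_hsNorm_left e (star B) (aux_isHS_star e h)
  rw [← star_mul, aux_hsNorm_star, aux_hsNorm_star, norm_star] at this
  linarith

theorem aux_isHS_sub (e : HilbertBasis ι ℂ H) {A B : H →L[ℂ] H}
    (hA : IsHS e A) (hB : IsHS e B) : IsHS e (A - B) := by
  refine Summable.of_nonneg_of_le (fun _ => by positivity) (fun i => ?_)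
    ((Summable.mul_left 2 hA).add (Summable.mul_left 2 hB))
  have h1 : ‖(A - B) (e i)‖ ≤ ‖A (e i)‖ + ‖B (e i)‖ := norm_sub_le _ _
  nlinarith [norm_nonneg ((A - B) (e i)), sq_nonneg (‖A (e i)‖ - ‖B (e i)‖)]

theorem aux_norm_le (e : HilbertBasis ι ℂ H) {A : H →L[ℂ] H} (h : IsHS e A) :
    ‖A‖ ≤ hsNorm e A := by
  refine ContinuousLinearMap.opNorm_le_bound _ (aux_hsNorm_nonneg e A) fun x => ?_
  refine le_of_sq_le_sq_aux ?_ (mul_nonneg (aux_hsNorm_nonneg e A) (norm_nonneg _))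
  have hs := aux_isHS_star e h
  rw [← aux_hsNorm_star, mul_pow, aux_hsNorm_sq]
  have h1 : ENNReal.ofReal (‖A x‖ ^ 2) ≤
      ENNReal.ofReal ((∑' i, ‖(star A) (e i)‖ ^ 2) * ‖x‖ ^ 2) := by
    rw [aux_enorm_sq_eq e, ← tsum_mul_right,
      ENNReal.ofReal_tsum_of_nonneg (fun _ => by positivity) (Summable.mul_right _ hs)]
    refine ENNReal.tsum_le_tsum fun i => ENNReal.ofReal_le_ofReal ?_
    rw [← mul_pow]
    gcongr
    rw [← ContinuousLinearMap.adjoint_inner_left, ← ContinuousLinearMap.star_eq_adjoint]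
    exact norm_inner_le_norm _ _
  refine (ENNReal.ofReal_le_ofReal_iff ?_).1 h1
  exact mul_nonneg (tsum_nonneg fun _ => by positivity) (by positivity)

/-- Restriction of an operator to finitely many basis vectors. -/
def auxL (e : HilbertBasis ι ℂ H) (s : Finset ι) :
    (H →L[ℂ] H) →L[ℂ] PiLp 2 (fun _ : s => H) :=
  ((PiLp.continuousLinearEquiv 2 ℂ (fun _ : s => H)).symm :
      (s → H) →L[ℂ] PiLp 2 (fun _ : s => H)) ∘L
    ContinuousLinearMap.pi fun i => ContinuousLinearMap.apply ℂ H (e i)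

theorem auxL_norm_sq (e : HilbertBasis ι ℂ H) (s : Finset ι) (A : H →L[ℂ] H) :
    ‖auxL e s A‖ ^ 2 = ∑ i ∈ s, ‖A (e i)‖ ^ 2 := by
  rw [PiLp.norm_sq_eq_of_L2, ← Finset.sum_coe_sort s]
  rfl

theorem auxL_le (e : HilbertBasis ι ℂ H) (s : Finset ι) {A : H →L[ℂ] H} (h : IsHS e A) :
    ‖auxL e s A‖ ≤ hsNorm e A := by
  refine le_of_sq_le_sq_aux ?_ (aux_hsNorm_nonneg e A)
  rw [auxL_norm_sq, aux_hsNorm_sq]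
  exact h.sum_le_tsum s (fun _ _ => by positivity)

theorem aux_hsNorm_le (e : HilbertBasis ι ℂ H) {A : H →L[ℂ] H} {C : ℝ} (hC : 0 ≤ C)
    (h : ∀ s, ‖auxL e s A‖ ≤ C) : hsNorm e A ≤ C := by
  refine le_of_sq_le_sq_aux ?_ hC
  rw [aux_hsNorm_sq]
  refine Real.tsum_le_of_sum_le (fun _ => by positivity) fun s => ?_
  rw [← auxL_norm_sq]
  gcongr
  exact h s

theorem auxL_sandwich (e : HilbertBasis ι ℂ H) (s : Finset ι) (U V : H →L[ℂ] H)
    {A : H →L[ℂ] H} (h : IsHS e A) {a b : ℝ} (hU : ‖U‖ ≤ a) (hV : ‖V‖ ≤ b) :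
    ‖auxL e s (U * A * V)‖ ≤ a * hsNorm e A * b := by
  have h0 := aux_hsNorm_nonneg e A
  calc _ ≤ hsNorm e (U * A * V) := auxL_le e s (aux_isHS_right e V (aux_isHS_left e U h))
    _ ≤ hsNorm e (U * A) * ‖V‖ := aux_hsNorm_right e V (aux_isHS_left e U h)
    _ ≤ (‖U‖ * hsNorm e A) * ‖V‖ := by gcongr; exact aux_hsNorm_left e U h
    _ ≤ _ := by
      have := (norm_nonneg U).trans hU
      gcongr

/-! ### Exponential -/

theorem aux_spec_le {A : H →L[ℂ] H} {x : ℝ} (hx : x ∈ spectrum ℝ A) : |x| ≤ ‖A‖ := by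
  have h := spectrum.norm_le_norm_mul_of_mem hx
  have h1 : ‖(1 : H →L[ℂ] H)‖ ≤ 1 := ContinuousLinearMap.norm_id_le
  rw [Real.norm_eq_abs] at h
  nlinarith [norm_nonneg A]

theorem aux_exp_norm {A : H →L[ℂ] H} (hA : IsSelfAdjoint A) :
    ‖NormedSpace.exp A‖ ≤ Real.exp ‖A‖ := by
  rw [← CFC.real_exp_eq_normedSpace_exp hA]
  refine norm_cfc_le (Real.exp_nonneg _) fun x hx => ?_
  rw [Real.norm_eq_abs, Real.abs_exp]
  exact Real.exp_le_exp.2 ((le_abs_self x).trans (aux_spec_le hx))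

theorem aux_exp_lip (e : HilbertBasis ι ℂ H) {X Y : H →L[ℂ] H} (hX : MemS2 e X)
    (hY : MemS2 e Y) {M : ℝ} (hXM : ‖X‖ ≤ M) (hYM : ‖Y‖ ≤ M) :
    hsNorm e (NormedSpace.exp Y - NormedSpace.exp X) ≤
      Real.exp M * hsNorm e (Y - X) * Real.exp M := by
  have hYX := aux_isHS_sub e hY.2 hX.2
  have hM : 0 ≤ M := (norm_nonneg _).trans hXM
  have bd : ∀ {Z : H →L[ℂ] H}, IsSelfAdjoint Z → ‖Z‖ ≤ M → ∀ t : ℝ, 0 ≤ t → t ≤ 1 →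
      ‖NormedSpace.exp (t • Z)‖ ≤ Real.exp M := by
    intro Z hZ hZM t h0 h1
    refine (aux_exp_norm ((IsSelfAdjoint.all t).smul hZ)).trans (Real.exp_le_exp.2 ?_)
    rw [norm_smul, Real.norm_eq_abs, abs_of_nonneg h0]
    nlinarith [norm_nonneg Z]
  refine aux_hsNorm_le e (by have := aux_hsNorm_nonneg e (Y - X); positivity) fun s => ?_
  let G : ℝ → (H →L[ℂ] H) := fun t => NormedSpace.exp (t • Y) * NormedSpace.exp ((1 - t) • X)
  have hG : ∀ t, HasDerivAt G
      (NormedSpace.exp (t • Y) * (Y - X) * NormedSpace.exp ((1 - t) • X)) t := by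
    intro t
    have h1 := hasDerivAt_exp_smul_const Y t
    have h2 := (hasDerivAt_exp_smul_const' X (1 - t)).scomp t ((hasDerivAt_id t).const_sub 1)
    have h3 := h1.mul h2
    refine h3.congr_deriv ?_
    simp only [Function.comp_apply, neg_smul, one_smul]
    noncomm_ring
  have h := norm_image_sub_le_of_norm_deriv_le_segment_01'
    (f := fun t => auxL e s (G t))
    (f' := fun t => auxL e s (NormedSpace.exp (t • Y) * (Y - X) * NormedSpace.exp ((1 - t) • X)))
    (C := Real.exp M * hsNorm e (Y - X) * Real.exp M)
    (fun t _ => (((auxL e s).restrictScalars ℝ).hasFDerivAt.comp_hasDerivAt t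
      (hG t)).hasDerivWithinAt)
    (fun t ht => auxL_sandwich e s _ _ hYX (bd hY.1 hYM t ht.1 ht.2.le)
      (bd hX.1 hXM (1 - t) (by linarith [ht.2]) (by linarith [ht.1])))
  simpa [G] using h

/-! ### Logarithm -/

theorem aux_log_integral {x : ℝ} (hx : 0 < x) :
    ∫ t in Set.Ioc (0:ℝ) 1, (x - 1) * (1 + t * (x - 1))⁻¹ = Real.log x := by
  rw [← intervalIntegral.integral_of_le zero_le_one]
  have hpos : ∀ t ∈ Set.uIcc (0:ℝ) 1, 0 < 1 + t * (x - 1) := by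
    intro t ht
    rw [Set.uIcc_of_le zero_le_one] at ht
    rcases ht.1.eq_or_lt with h | h
    · rw [← h]; simp
    · nlinarith [mul_pos h hx, ht.2]
  have := intervalIntegral.integral_eq_sub_of_hasDerivAt (a := 0) (b := 1)
    (f := fun t => Real.log (1 + t * (x - 1)))
    (f' := fun t => (x - 1) * (1 + t * (x - 1))⁻¹) (fun t ht => ?_) ?_
  · rw [this]; simp
  · have h1 : HasDerivAt (fun t : ℝ => 1 + t * (x - 1)) (x - 1) t := by
      simpa using ((hasDerivAt_id t).mul_const (x - 1)).const_add 1
    simpa [div_eq_mul_inv] using h1.log (hpos t ht).ne'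
  · refine ContinuousOn.intervalIntegrable ?_
    refine continuousOn_const.mul (ContinuousOn.inv₀ (by fun_prop) fun t ht => (hpos t ht).ne')

theorem aux_lower {m t x : ℝ} (hm1 : m ≤ 1) (ht0 : 0 ≤ t) (ht1 : t ≤ 1) (hx : m ≤ x) :
    m ≤ 1 + t * (x - 1) := by
  nlinarith [mul_nonneg ht0 (sub_nonneg.2 hx), mul_nonneg (sub_nonneg.2 ht1) (sub_nonneg.2 hm1)]

theorem aux_plog_integral {p : H →L[ℂ] H} (hp : IsSelfAdjoint p) {m : ℝ} (hm : 0 < m)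
    (hm1 : m ≤ 1) (hs : ∀ x ∈ spectrum ℝ p, m ≤ x) :
    MeasureTheory.IntegrableOn
      (fun t : ℝ => cfc (fun x : ℝ => (x - 1) * (1 + t * (x - 1))⁻¹) p) (Set.Ioc (0:ℝ) 1) ∧
    plog p = ∫ t in Set.Ioc (0:ℝ) 1, cfc (fun x : ℝ => (x - 1) * (1 + t * (x - 1))⁻¹) p := by
  have hc : ContinuousOn (Function.uncurry fun t x : ℝ => (x - 1) * (1 + t * (x - 1))⁻¹)
      (Set.Ioc (0:ℝ) 1 ×ˢ spectrum ℝ p) := by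
    have : (Function.uncurry fun t x : ℝ => (x - 1) * (1 + t * (x - 1))⁻¹) =
      fun z : ℝ × ℝ => (z.2 - 1) * (1 + z.1 * (z.2 - 1))⁻¹ := rfl
    rw [this]
    refine ContinuousOn.mul (by fun_prop) (ContinuousOn.inv₀ (by fun_prop) fun z hz => ?_)
    have := aux_lower hm1 hz.1.1.le hz.1.2 (hs _ hz.2)
    linarith
  have hb : ∀ᵐ t ∂(MeasureTheory.volume.restrict (Set.Ioc (0:ℝ) 1)), ∀ x ∈ spectrum ℝ p,
      ‖(x - 1) * (1 + t * (x - 1))⁻¹‖ ≤ (‖p‖ + 1) * m⁻¹ := by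
    refine MeasureTheory.ae_restrict_of_forall_mem measurableSet_Ioc fun t ht x hx => ?_
    have h1 := aux_lower hm1 ht.1.le ht.2 (hs _ hx)
    rw [norm_mul, norm_inv, Real.norm_eq_abs, Real.norm_eq_abs,
      abs_of_pos (lt_of_lt_of_le hm h1)]
    have h5 : 0 < 1 + t * (x - 1) := hm.trans_le h1
    gcongr
    have h2 := norm_sub_le x 1
    rw [Real.norm_eq_abs, Real.norm_eq_abs, norm_one] at h2
    linarith [aux_spec_le hx]
  have hf : MeasureTheory.HasFiniteIntegral (fun _ : ℝ => (‖p‖ + 1) * m⁻¹)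
      (MeasureTheory.volume.restrict (Set.Ioc (0:ℝ) 1)) :=
    (MeasureTheory.integrable_const _).hasFiniteIntegral
  refine ⟨integrableOn_cfc measurableSet_Ioc _ _ p hc hb hf hp, ?_⟩
  rw [← cfc_setIntegral measurableSet_Ioc _ _ p hc hb hf hp]
  exact cfc_congr fun x hx => (aux_log_integral (hm.trans_le (hs x hx))).symm

theorem aux_resolvent {p : H →L[ℂ] H} (hp : IsSelfAdjoint p) {m t : ℝ} (hm : 0 < m)
    (hm1 : m ≤ 1) (hs : ∀ x ∈ spectrum ℝ p, m ≤ x) (ht0 : 0 ≤ t) (ht1 : t ≤ 1) :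
    ∃ R : H →L[ℂ] H, ‖R‖ ≤ m⁻¹ ∧ R * (1 + t • (p - 1)) = 1 ∧ (1 + t • (p - 1)) * R = 1 ∧
      cfc (fun x : ℝ => (x - 1) * (1 + t * (x - 1))⁻¹) p = (p - 1) * R ∧
      cfc (fun x : ℝ => (x - 1) * (1 + t * (x - 1))⁻¹) p = R * (p - 1) := by
  have hl : ∀ x ∈ spectrum ℝ p, m ≤ 1 + t * (x - 1) := fun x hx =>
    aux_lower hm1 ht0 ht1 (hs x hx)
  have hc : ContinuousOn (fun x : ℝ => (1 + t * (x - 1))⁻¹) (spectrum ℝ p) :=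
    ContinuousOn.inv₀ (by fun_prop) fun x hx => (hm.trans_le (hl x hx)).ne'
  have e1 : cfc (fun x : ℝ => x - 1) p = p - 1 := by
    rw [cfc_sub (fun x : ℝ => x) (fun _ => (1:ℝ)) p, cfc_id' ℝ p, cfc_const_one ℝ p]
  have e2 : cfc (fun x : ℝ => 1 + t * (x - 1)) p = 1 + t • (p - 1) := by
    rw [cfc_add (a := p) (fun _ : ℝ => (1:ℝ)) (fun x => t * (x - 1)), cfc_const_one ℝ p,
      cfc_const_mul t (fun x : ℝ => x - 1) p, e1]
  refine ⟨cfc (fun x : ℝ => (1 + t * (x - 1))⁻¹) p, ?_, ?_, ?_, ?_, ?_⟩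
  · refine norm_cfc_le (by positivity) fun x hx => ?_
    have h1 := hl x hx
    rw [norm_inv, Real.norm_eq_abs, abs_of_pos (hm.trans_le h1)]
    gcongr
  · rw [← e2, ← cfc_mul _ _ p hc (by fun_prop), ← cfc_const_one ℝ p]
    exact cfc_congr fun x hx => inv_mul_cancel₀ (hm.trans_le (hl x hx)).ne'
  · rw [← e2, ← cfc_mul _ _ p (by fun_prop) hc, ← cfc_const_one ℝ p]
    exact cfc_congr fun x hx => mul_inv_cancel₀ (hm.trans_le (hl x hx)).ne'
  · rw [cfc_mul _ _ p (by fun_prop) hc, e1]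
  · rw [← e1, ← cfc_mul _ _ p hc (by fun_prop)]
    exact cfc_congr fun x hx => mul_comm _ _

theorem aux_log_lip (e : HilbertBasis ι ℂ H) {p q : H →L[ℂ] H} (hp : IsSelfAdjoint p)
    (hq : IsSelfAdjoint q) (hqp : IsHS e (q - p)) {m : ℝ} (hm : 0 < m) (hm1 : m ≤ 1)
    (hps : ∀ x ∈ spectrum ℝ p, m ≤ x) (hqs : ∀ x ∈ spectrum ℝ q, m ≤ x) :
    hsNorm e (plog q - plog p) ≤ m⁻¹ * hsNorm e (q - p) * m⁻¹ := by
  have h0 := aux_hsNorm_nonneg e (q - p)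
  refine aux_hsNorm_le e (by positivity) fun s => ?_
  obtain ⟨ip, ep⟩ := aux_plog_integral hp hm hm1 hps
  obtain ⟨iq, eq⟩ := aux_plog_integral hq hm hm1 hqs
  rw [ep, eq, ← MeasureTheory.integral_sub iq ip]
  have hcomm := ContinuousLinearMap.integral_comp_comm (auxL e s) (iq.sub ip)
  simp only [Pi.sub_apply] at hcomm
  rw [← hcomm]
  have hb := MeasureTheory.norm_setIntegral_le_of_norm_le_const
    (μ := MeasureTheory.volume) (s := Set.Ioc (0:ℝ) 1)
    (C := m⁻¹ * hsNorm e (q - p) * m⁻¹)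
    (f := fun t : ℝ => auxL e s (cfc (fun x : ℝ => (x - 1) * (1 + t * (x - 1))⁻¹) q -
      cfc (fun x : ℝ => (x - 1) * (1 + t * (x - 1))⁻¹) p)) (by simp) ?_
  · simpa using hb
  intro t ht
  obtain ⟨R, hR, hR1, hR2, hR3, hR4⟩ := aux_resolvent hp hm hm1 hps ht.1.le ht.2
  obtain ⟨S, hS, hS1, hS2, hS3, hS4⟩ := aux_resolvent hq hm hm1 hqs ht.1.le ht.2
  have key : cfc (fun x : ℝ => (x - 1) * (1 + t * (x - 1))⁻¹) q -
      cfc (fun x : ℝ => (x - 1) * (1 + t * (x - 1))⁻¹) p = S * (q - p) * R := by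
    rw [hS4, hR3]
    have h1 : S * (q - 1) = S * (q - 1) * ((1 + t • (p - 1)) * R) := by rw [hR2, mul_one]
    have h2 : (p - 1) * R = (S * (1 + t • (q - 1))) * ((p - 1) * R) := by rw [hS1, one_mul]
    rw [h1, h2]
    simp only [mul_add, add_mul, mul_smul_comm, smul_mul_assoc, mul_one, one_mul, mul_sub,
      sub_mul, smul_sub, mul_assoc]
    abel
  rw [key]
  exact auxL_sandwich e s S R hqp hS hR

theorem aux_memP_lower (e : HilbertBasis ι ℂ H) {p : H →L[ℂ] H} (hp : MemP e p) :
    0 ≤ p ∧ ∃ m : ℝ, 0 < m ∧ m ≤ 1 ∧ ∀ x ∈ spectrum ℝ p, m ≤ x := by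
  have h0 : 0 ≤ p := by
    rw [ContinuousLinearMap.nonneg_iff_isPositive]
    exact ⟨hp.1.isSymmetric, hp.2.2.1⟩
  have hpos : ∀ x ∈ spectrum ℝ p, 0 < x := by
    intro x hx
    refine lt_of_le_of_ne (spectrum_nonneg_of_nonneg h0 hx) ?_
    rintro rfl
    exact spectrum.zero_notMem ℝ hp.2.1 hx
  refine ⟨h0, ?_⟩
  rcases (spectrum ℝ p).eq_empty_or_nonempty with h | h
  · exact ⟨1, one_pos, le_rfl, fun x hx => by simp [h] at hx⟩
  · obtain ⟨r, hr, hr2⟩ := (ContinuousFunctionalCalculus.isCompact_spectrum (R := ℝ) p).exists_isMinOn h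
      continuousOn_id
    exact ⟨min r 1, lt_min (hpos r hr) one_pos, min_le_right _ _,
      fun x hx => (min_le_left _ _).trans (hr2 hx)⟩

theorem aux_near {p q : H →L[ℂ] H} (hp : IsSelfAdjoint p) (hq : IsSelfAdjoint q) {m : ℝ}
    (hps : ∀ x ∈ spectrum ℝ p, m ≤ x) (h : ‖q - p‖ ≤ m / 2) :
    ∀ x ∈ spectrum ℝ q, m / 2 ≤ x := by
  rw [← algebraMap_le_iff_le_spectrum hq]
  rw [← algebraMap_le_iff_le_spectrum hp] at hps
  have h1 := (hq.sub hp).neg_algebraMap_norm_le_self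
  have h2 : algebraMap ℝ (H →L[ℂ] H) ‖q - p‖ ≤ algebraMap ℝ (H →L[ℂ] H) (m / 2) :=
    algebraMap_mono _ h
  have h3 : algebraMap ℝ (H →L[ℂ] H) m =
      algebraMap ℝ (H →L[ℂ] H) (m / 2) + algebraMap ℝ (H →L[ℂ] H) (m / 2) := by
    rw [← map_add, add_halves]
  rw [h3] at hps
  have h4 := add_le_add hps ((neg_le_neg h2).trans h1)
  simpa using h4

theorem aux_factor {p : H →L[ℂ] H} (hp : IsSelfAdjoint p) (f : ℝ → ℝ) (a : ℝ)
    (hf : ContinuousOn f (spectrum ℝ p)) (hd : DifferentiableAt ℝ f a) :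
    ∃ B : H →L[ℂ] H, cfc f p - algebraMap ℝ _ (f a) = B * (p - algebraMap ℝ _ a) := by
  have hc : ContinuousOn (dslope f a) (spectrum ℝ p) := by
    intro x hx
    by_cases hxa : x = a
    · subst hxa
      exact (continuousAt_dslope_same.2 hd).continuousWithinAt
    · exact (continuousWithinAt_dslope_of_ne hxa).2 (hf x hx)
  refine ⟨cfc (dslope f a) p, ?_⟩
  have e1 : cfc (fun x : ℝ => x - a) p = p - algebraMap ℝ _ a := by
    rw [cfc_sub (fun x : ℝ => x) (fun _ => a) p, cfc_id' ℝ p, cfc_const a p]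
  rw [← e1, ← cfc_mul _ _ p hc (by fun_prop), ← cfc_const (f a) p, ← cfc_sub f _ p hf]
  refine cfc_congr fun x hx => ?_
  have := sub_smul_dslope f a x
  simp only [smul_eq_mul] at this
  rw [← this, mul_comm]

/-- The exponential map is a bijection from `S₂(H)` onto `P` with
inverse `log`, and it is a homeomorphism for the Hilbert–Schmidt distance. -/
theorem statement3 (e : HilbertBasis ι ℂ H) :
    (∀ X : H →L[ℂ] H, MemS2 e X → MemP e (NormedSpace.exp X)) ∧
    (∀ p : H →L[ℂ] H, MemP e p → MemS2 e (plog p) ∧ NormedSpace.exp (plog p) = p) ∧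
    (∀ X : H →L[ℂ] H, MemS2 e X → plog (NormedSpace.exp X) = X) ∧
    (∀ X : H →L[ℂ] H, MemS2 e X → ∀ ε > (0:ℝ), ∃ δ > (0:ℝ), ∀ Y : H →L[ℂ] H, MemS2 e Y →
      hsNorm e (Y - X) < δ → hsNorm e (NormedSpace.exp Y - NormedSpace.exp X) < ε) ∧
    (∀ p : H →L[ℂ] H, MemP e p → ∀ ε > (0:ℝ), ∃ δ > (0:ℝ), ∀ q : H →L[ℂ] H, MemP e q →
      hsNorm e (q - p) < δ → hsNorm e (plog q - plog p) < ε) := by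
  refine ⟨?_, ?_, ?_, ?_, ?_⟩
  · intro X hX
    have hsa : IsSelfAdjoint (NormedSpace.exp X) := hX.1.exp
    refine ⟨hsa, ?_, ?_, ?_⟩
    · let +nondep : NormedAlgebra ℚ (H →L[ℂ] H) := .restrictScalars ℚ ℂ (H →L[ℂ] H)
      have h1 : NormedSpace.exp X * NormedSpace.exp (-X) = 1 := by
        rw [← NormedSpace.exp_add_of_commute (Commute.neg_right (Commute.refl X))]
        simp
      have h2 : NormedSpace.exp (-X) * NormedSpace.exp X = 1 := by
        rw [← NormedSpace.exp_add_of_commute (Commute.neg_left (Commute.refl X))]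
        simp
      exact ⟨⟨_, _, h1, h2⟩, rfl⟩
    · have h := hX.1.exp_nonneg
      rw [ContinuousLinearMap.nonneg_iff_isPositive] at h
      exact h.2
    · obtain ⟨B, hB⟩ := aux_factor hX.1 Real.exp 0 (by fun_prop) (by fun_prop)
      rw [CFC.real_exp_eq_normedSpace_exp hX.1] at hB
      simp only [Real.exp_zero, map_one, map_zero, sub_zero] at hB
      rw [hB]
      exact aux_isHS_left e B hX.2
  · intro p hp
    obtain ⟨h0, m, hm, hm1, hs⟩ := aux_memP_lower e hp
    refine ⟨⟨IsSelfAdjoint.log, ?_⟩, ?_⟩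
    · obtain ⟨B, hB⟩ := aux_factor hp.1 Real.log 1
        (Real.continuousOn_log.mono fun x hx => (hm.trans_le (hs x hx)).ne')
        (Real.differentiableAt_log one_ne_zero)
      simp only [Real.log_one, map_one, map_zero, sub_zero] at hB
      unfold plog
      rw [hB]
      exact aux_isHS_left e B hp.2.2.2
    · exact CFC.exp_log p (hp.2.1.isStrictlyPositive h0)
  · intro X hX
    exact CFC.log_exp X hX.1
  · intro X hX ε hε
    have hC : 0 < Real.exp (‖X‖ + 1) * Real.exp (‖X‖ + 1) := by positivity
    refine ⟨min 1 (ε / (Real.exp (‖X‖ + 1) * Real.exp (‖X‖ + 1))),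
      lt_min one_pos (div_pos hε hC), fun Y hY hYX => ?_⟩
    have hn := aux_norm_le e (aux_isHS_sub e hY.2 hX.2)
    have hY1 : ‖Y‖ ≤ ‖X‖ + 1 := by
      have h1 := norm_le_norm_add_norm_sub X Y
      rw [norm_sub_rev] at h1
      linarith [hYX.trans_le (min_le_left _ _)]
    have h := aux_exp_lip e hX hY (M := ‖X‖ + 1) (by linarith) hY1
    have h2 := (lt_div_iff₀ hC).1 (hYX.trans_le (min_le_right _ _))
    linarith
  · intro p hp ε hε
    obtain ⟨h0, m, hm, hm1, hs⟩ := aux_memP_lower e hp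
    have hC : 0 < (m / 2)⁻¹ * (m / 2)⁻¹ := by positivity
    refine ⟨min (m / 2) (ε / ((m / 2)⁻¹ * (m / 2)⁻¹)),
      lt_min (by positivity) (div_pos hε hC), fun q hq hqp => ?_⟩
    have hHS : IsHS e (q - p) := by
      have := aux_isHS_sub e hq.2.2.2 hp.2.2.2
      simpa using this
    have hn := aux_norm_le e hHS
    have hqs := aux_near hp.1 hq.1 hs (hn.trans (hqp.le.trans (min_le_left _ _)))
    have h := aux_log_lip e hp.1 hq.1 hHS (m := m / 2) (by positivity) (by linarith)
      (fun x hx => by linarith [hs x hx]) hqs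
    have h2 := (lt_div_iff₀ hC).1 (hqp.trans_le (min_le_right _ _))
    linarith
end
end

section
/- Let A be a unital Banach algebra over ℝ or ℂ and X ∈ A. Then the Fréchet differential of exp at X factors as d_X exp (Y) = exp(X/2) · τ_X(Y) · exp(X/2) for all Y ∈ A, where τ_X(Y) = ∑_{n=0}^∞ (1/(2n+1)!) · (ad X / 2)^{2n}(Y). -/
noncomputable section

namespace ExpFac

open NormedSpace

variable {𝕜 : Type*} [RCLike 𝕜] {B : Type*} [NormedRing B] [NormedAlgebra 𝕜 B]

/-- `Q l r n = ∑_{i+j=n-1} l^i r^j`. -/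
def Q {B : Type*} [Ring B] (l r : B) : ℕ → B
  | 0 => 0
  | n + 1 => l * Q l r n + r ^ n

lemma norm_pow_bound (r : B) (R : ℝ) (hr : ‖r‖ ≤ R) (n : ℕ) :
    ‖r ^ n‖ ≤ ‖(1 : B)‖ * R ^ n := by
  induction n with
  | zero => simp
  | succ n ih =>
    have hR : 0 ≤ R := (norm_nonneg r).trans hr
    calc ‖r ^ (n + 1)‖ ≤ ‖r ^ n‖ * ‖r‖ := by rw [pow_succ]; exact norm_mul_le _ _
      _ ≤ (‖(1 : B)‖ * R ^ n) * R := by gcongr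
      _ = _ := by ring

lemma norm_Q_bound (l r : B) (R : ℝ) (h1 : 1 ≤ R) (hl : ‖l‖ ≤ R) (hr : ‖r‖ ≤ R) (n : ℕ) :
    ‖Q l r n‖ ≤ ‖(1 : B)‖ * (2 * R) ^ n := by
  induction n with
  | zero => simp [Q]
  | succ n ih =>
    have hR : 0 ≤ R := (norm_nonneg r).trans hr
    have hp := norm_pow_bound r R hr n
    have h2 : R ^ n ≤ R * (2 * R) ^ n := by
      calc R ^ n ≤ (2 * R) ^ n := by gcongr; linarith
        _ ≤ R * (2 * R) ^ n := le_mul_of_one_le_left (by positivity) h1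
    calc ‖Q l r (n + 1)‖ ≤ ‖l‖ * ‖Q l r n‖ + ‖r ^ n‖ :=
          (norm_add_le _ _).trans (by gcongr; exact norm_mul_le _ _)
      _ ≤ R * (‖(1 : B)‖ * (2 * R) ^ n) + ‖(1 : B)‖ * (R * (2 * R) ^ n) := by
          gcongr
          exact hp.trans (by gcongr)
      _ = _ := by ring

lemma summable_bound (C K : ℝ) : Summable (fun n : ℕ => (n.factorial : ℝ)⁻¹ * (C * K ^ n)) := by
  have := (Real.summable_pow_div_factorial K).mul_left C
  refine this.congr fun n => ?_
  field_simp

/-- entire series -/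
def E (𝕜 : Type*) [RCLike 𝕜] {B : Type*} [NormedRing B] [NormedAlgebra 𝕜 B]
    (c : ℕ → B) (t : 𝕜) : B := ∑' n : ℕ, ((n.factorial : 𝕜)⁻¹ * t ^ n) • c n

lemma norm_term_le (c : ℕ → B) (C K : ℝ) (hc : ∀ n, ‖c n‖ ≤ C * K ^ n) (T : ℝ) (t : 𝕜)
    (ht : ‖t‖ ≤ T) (n : ℕ) :
    ‖((n.factorial : 𝕜)⁻¹ * t ^ n) • c n‖ ≤ (n.factorial : ℝ)⁻¹ * (C * (T * K) ^ n) := by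
  have hT : 0 ≤ T := (norm_nonneg t).trans ht
  rw [norm_smul, norm_mul, norm_inv, RCLike.norm_natCast, norm_pow]
  calc (n.factorial : ℝ)⁻¹ * ‖t‖ ^ n * ‖c n‖
      ≤ (n.factorial : ℝ)⁻¹ * T ^ n * (C * K ^ n) := by gcongr; exact hc n
    _ = _ := by rw [mul_pow]; ring

variable [CompleteSpace B]

lemma summable_E (c : ℕ → B) (C K : ℝ) (hc : ∀ n, ‖c n‖ ≤ C * K ^ n) (t : 𝕜) :
    Summable (fun n : ℕ => ((n.factorial : 𝕜)⁻¹ * t ^ n) • c n) :=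
  .of_norm_bounded (summable_bound C (‖t‖ * K)) (norm_term_le c C K hc _ t le_rfl)

lemma hasDerivAt_E (c : ℕ → B) (C K : ℝ) (hc : ∀ n, ‖c n‖ ≤ C * K ^ n) (t : 𝕜) :
    HasDerivAt (E 𝕜 c) (E 𝕜 (fun n => c (n + 1)) t) t := by
  have hc' : ∀ n, ‖c (n + 1)‖ ≤ (C * K) * K ^ n := fun n => (hc (n + 1)).trans_eq (by ring)
  have key : HasDerivAt (fun z : 𝕜 => ∑' n : ℕ, (((n + 1).factorial : 𝕜)⁻¹ * z ^ (n + 1)) • c (n + 1))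
      (E 𝕜 (fun n => c (n + 1)) t) t := by
    refine hasDerivAt_tsum_of_isPreconnected (t := Metric.ball (0 : 𝕜) (‖t‖ + 1)) (y₀ := 0)
      (g' := fun n z => ((n.factorial : 𝕜)⁻¹ * z ^ n) • c (n + 1))
      (summable_bound (C * K) ((‖t‖ + 1) * K)) Metric.isOpen_ball
      (convex_ball _ _).isPreconnected ?_ ?_ ?_ ?_ ?_
    · intro n y _
      have := (((hasDerivAt_pow (n + 1) y).const_mul (((n + 1).factorial : 𝕜)⁻¹))).smul_const
        (c (n + 1))
      refine this.congr_deriv ?_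
      congr 1
      have h1 : ((n : 𝕜) + 1) ≠ 0 := Nat.cast_add_one_ne_zero n
      have h2 : (n.factorial : 𝕜) ≠ 0 := Nat.cast_ne_zero.2 n.factorial_ne_zero
      rw [Nat.factorial_succ]
      push_cast
      field_simp
    · intro n y hy
      exact norm_term_le (fun n => c (n + 1)) _ _ hc' _ y
        (by simpa using (mem_ball_zero_iff.1 hy).le) n
    · exact Metric.mem_ball_self (by positivity)
    · simpa using (summable_zero : Summable (fun _ : ℕ => (0 : B)))
    · exact mem_ball_zero_iff.2 (by linarith)
  have h2 : E 𝕜 c = fun z => c 0 +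
      ∑' n : ℕ, (((n + 1).factorial : 𝕜)⁻¹ * z ^ (n + 1)) • c (n + 1) := by
    funext z
    rw [E, (summable_E c C K hc z).tsum_eq_zero_add]
    simp
  rw [h2]
  exact key.const_add _

lemma E_pow (r : B) (t : 𝕜) : E 𝕜 (fun n => r ^ n) t = exp (t • r) := by
  rw [exp_eq_tsum 𝕜, E]
  refine tsum_congr fun n => ?_
  rw [smul_pow, smul_smul]

lemma hasDerivAt_EQ (l r : B) (t : 𝕜) :
    HasDerivAt (E 𝕜 (Q l r)) (l * E 𝕜 (Q l r) t + exp (t • r)) t := by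
  set R := 1 + ‖l‖ + ‖r‖ with hR
  have hl : ‖l‖ ≤ R := by have := norm_nonneg r; linarith
  have hr : ‖r‖ ≤ R := by have := norm_nonneg l; linarith
  have h1 : 1 ≤ R := by have := norm_nonneg l; have := norm_nonneg r; linarith
  have hQ := norm_Q_bound l r R h1 hl hr
  have := hasDerivAt_E (Q l r) _ _ hQ t
  convert this using 1
  have s1 := (summable_E (Q l r) _ _ hQ t)
  have s2 := (summable_E (fun n => r ^ n) _ _ (norm_pow_bound r R hr) t)
  rw [← E_pow, E, E, E, ← s1.tsum_mul_left, ← (s1.mul_left l).tsum_add s2]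
  refine tsum_congr fun n => ?_
  simp only [Q, smul_add, mul_smul_comm]

lemma E_zero (l r : B) : E 𝕜 (Q l r) 0 = 0 := by
  rw [E]
  refine (tsum_congr fun n => ?_).trans tsum_zero
  cases n <;> simp [Q]

lemma exp_add' (𝕜 : Type*) [RCLike 𝕜] {B : Type*} [NormedRing B] [NormedAlgebra 𝕜 B]
    [CompleteSpace B] {x y : B} (h : Commute x y) : exp (x + y) = exp x * exp y :=
  exp_add_of_commute_of_mem_ball (𝕂 := 𝕜) h
    ((expSeries_radius_eq_top 𝕜 B).symm ▸ edist_lt_top _ _)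
    ((expSeries_radius_eq_top 𝕜 B).symm ▸ edist_lt_top _ _)

lemma EQ_eq (l r m a : B) (hma : Commute m a) (hl : m + a = l) (hr : m - a = r) (t : 𝕜) :
    E 𝕜 (Q l r) t = exp (t • m) * E 𝕜 (Q a (-a)) t := by
  let F : 𝕜 → B := fun t => E 𝕜 (Q l r) t - exp (t • m) * E 𝕜 (Q a (-a)) t
  have hF : ∀ t, HasDerivAt F (l * F t) t := by
    intro t
    have h1 := hasDerivAt_EQ l r t
    have h2 := (hasDerivAt_exp_smul_const' (𝕂 := 𝕜) m t).mul (hasDerivAt_EQ a (-a) t)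
    refine (h1.sub h2).congr_deriv ?_
    have hc : a * exp (t • m) = exp (t • m) * a :=
      ((hma.symm.smul_right t).exp_right)
    have he : exp (t • r) = exp (t • m) * exp (t • (-a)) := by
      rw [← exp_add' 𝕜, ← hr]
      · congr 1
        rw [smul_sub, smul_neg, sub_eq_add_neg]
      · exact (hma.neg_right.smul_left t).smul_right t
    simp only [F]
    rw [he, ← hl, mul_add (exp (t • m)), ← mul_assoc (exp (t • m)) a, ← hc]
    noncomm_ring
  have hW : ∀ t, HasDerivAt (fun t : 𝕜 => exp (t • (-l)) * F t) 0 t := by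
    intro t
    refine ((hasDerivAt_exp_smul_const (𝕂 := 𝕜) (-l) t).mul (hF t)).congr_deriv ?_
    noncomm_ring
  have hconst := is_const_of_deriv_eq_zero (𝕜 := 𝕜) (fun t => (hW t).differentiableAt)
    (fun t => (hW t).deriv) t 0
  have h0 : exp (t • (-l)) * F t = 0 := by
    rw [hconst]
    simp [F, E_zero]
  have hinv : exp (t • l) * exp (t • (-l)) = 1 := by
    rw [← exp_add' 𝕜]
    · simp
    · exact ((Commute.refl l).neg_right.smul_left t).smul_right t
  have : F t = 0 := by
    rw [← one_mul (F t), ← hinv, mul_assoc, h0, mul_zero]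
  exact sub_eq_zero.1 this

lemma Q_alt {B : Type*} [Ring B] (a : B) (k : ℕ) :
    Q a (-a) (2 * k) = 0 ∧ Q a (-a) (2 * k + 1) = a ^ (2 * k) := by
  induction k with
  | zero => simp [Q]
  | succ k ih =>
    have h : Q a (-a) (2 * (k + 1)) = 0 := by
      change a * Q a (-a) (2 * k + 1) + (-a) ^ (2 * k + 1) = 0
      rw [ih.2, Odd.neg_pow ⟨k, rfl⟩, ← pow_succ']
      simp
    refine ⟨h, ?_⟩
    change a * Q a (-a) (2 * (k + 1)) + (-a) ^ (2 * (k + 1)) = _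
    rw [h, Even.neg_pow ⟨k + 1, by ring⟩]
    simp

lemma EQ_alt (a : B) :
    E 𝕜 (Q a (-a)) 1 = ∑' n : ℕ, ((2 * n + 1).factorial : 𝕜)⁻¹ • a ^ (2 * n) := by
  rw [E]
  have hinj : Function.Injective (fun n : ℕ => 2 * n + 1) := fun a b h => by
    simp only at h; omega
  rw [← hinj.tsum_eq]
  · refine tsum_congr fun n => ?_
    rw [(Q_alt a n).2]
    simp
  · intro n hn
    by_contra hcon
    apply hn
    obtain ⟨k, hk | hk⟩ := Nat.even_or_odd' n
    · simp [hk, (Q_alt a k).1]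
    · exact absurd ⟨k, hk.symm⟩ hcon

lemma summable_alt (a : B) :
    Summable (fun n : ℕ => ‖((2 * n + 1).factorial : 𝕜)⁻¹ • a ^ (2 * n)‖) := by
  set R := 1 + ‖a‖ with hR
  have hl : ‖a‖ ≤ R := by linarith
  have h1 : 1 ≤ R := by have := norm_nonneg a; linarith
  have hQ := norm_Q_bound a (-a) R h1 hl (by simpa using hl)
  have hs : Summable (fun n : ℕ => ‖((n.factorial : 𝕜)⁻¹ * (1 : 𝕜) ^ n) • Q a (-a) n‖) :=
    .of_nonneg_of_le (fun _ => norm_nonneg _)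
      (norm_term_le (Q a (-a)) _ _ hQ _ (1 : 𝕜) le_rfl) (summable_bound _ _)
  have hinj : Function.Injective (fun n : ℕ => 2 * n + 1) := fun a b h => by
    simp only at h; omega
  refine (hs.comp_injective hinj).congr fun n => ?_
  simp [(Q_alt a n).2]

variable (𝕜) in
lemma hasFDerivAt_pow_Q (x : B) (n : ℕ) :
    HasFDerivAt (fun y : B => y ^ n)
      (Q (ContinuousLinearMap.mul 𝕜 B x) ((ContinuousLinearMap.mul 𝕜 B).flip x) n) x := by
  induction n with
  | zero => simpa [Q] using hasFDerivAt_const (𝕜 := 𝕜) (1 : B) x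
  | succ n ih =>
    have h := (hasFDerivAt_id (𝕜 := 𝕜) x).fun_mul' ih
    simp only [pow_succ']
    refine HasFDerivAt.congr_fderiv (f := fun y : B => y * y ^ n) h ?_
    ext y
    have hp : ∀ n : ℕ, (((ContinuousLinearMap.mul 𝕜 B).flip x) ^ n) y = y * x ^ n := by
      intro n
      induction n with
      | zero => simp
      | succ n ih => rw [pow_succ', ContinuousLinearMap.mul_apply, ih]; simp [pow_succ, mul_assoc]
    simp [Q, hp]

variable (𝕜) in
lemma hasFDerivAt_exp_Q (x : B) :
    HasFDerivAt (exp : B → B)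
      (E 𝕜 (Q (ContinuousLinearMap.mul 𝕜 B x) ((ContinuousLinearMap.mul 𝕜 B).flip x)) (1 : 𝕜)) x := by
  rw [exp_eq_tsum 𝕜]
  letI : NormedSpace ℝ B := NormedSpace.restrictScalars ℝ 𝕜 B
  have hE : E 𝕜 (Q (ContinuousLinearMap.mul 𝕜 B x) ((ContinuousLinearMap.mul 𝕜 B).flip x)) (1 : 𝕜)
    = ∑' n : ℕ, (n.factorial : 𝕜)⁻¹ •
      Q (ContinuousLinearMap.mul 𝕜 B x) ((ContinuousLinearMap.mul 𝕜 B).flip x) n := by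
    simp [E]
  rw [hE]
  refine hasFDerivAt_tsum_of_isPreconnected (s := Metric.ball (0 : B) (‖x‖ + 1)) (x₀ := 0)
    (f' := fun n z => (n.factorial : 𝕜)⁻¹ •
      Q (ContinuousLinearMap.mul 𝕜 B z) ((ContinuousLinearMap.mul 𝕜 B).flip z) n)
    (summable_bound ‖(1 : B →L[𝕜] B)‖ (1 * (2 * (‖x‖ + 1)))) Metric.isOpen_ball
    (convex_ball _ _).isPreconnected ?_ ?_ ?_ ?_ ?_
  · intro n y _
    exact (hasFDerivAt_pow_Q 𝕜 y n).const_smul ((n.factorial : 𝕜)⁻¹)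
  · intro n y hy
    have hy' : ‖y‖ ≤ ‖x‖ + 1 := (mem_ball_zero_iff.1 hy).le
    have h1 : ‖ContinuousLinearMap.mul 𝕜 B y‖ ≤ ‖x‖ + 1 :=
      (ContinuousLinearMap.opNorm_mul_apply_le 𝕜 B y).trans hy'
    have h2 : ‖(ContinuousLinearMap.mul 𝕜 B).flip y‖ ≤ ‖x‖ + 1 := by
      refine le_trans (ContinuousLinearMap.opNorm_le_bound _ (norm_nonneg y) fun z => ?_) hy'
      simpa [mul_comm ‖y‖] using norm_mul_le z y
    have := norm_term_le (𝕜 := 𝕜) _ _ _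
      (norm_Q_bound _ _ (‖x‖ + 1) (by have := norm_nonneg x; linarith) h1 h2) 1 1 (by simp) n
    simpa using this
  · exact Metric.mem_ball_self (by positivity)
  · exact expSeries_summable' 0
  · exact mem_ball_zero_iff.2 (by linarith)

/-- a continuous linear map preserving powers preserves `exp`. -/
lemma map_exp' {C : Type*} [NormedRing C] [NormedAlgebra 𝕜 C] [CompleteSpace C]
    (φ : B →L[𝕜] C) (x : B) (h : ∀ n : ℕ, φ (x ^ n) = φ x ^ n) : φ (exp x) = exp (φ x) := by
  rw [exp_eq_tsum 𝕜, exp_eq_tsum 𝕜]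
  simp only
  rw [φ.map_tsum (expSeries_summable' x)]
  simp [h]

lemma mul_exp (x : B) : ContinuousLinearMap.mul 𝕜 B (exp x) =
    exp (ContinuousLinearMap.mul 𝕜 B x) := by
  refine map_exp' _ x fun n => ?_
  induction n with
  | zero => ext; simp
  | succ n ih => rw [pow_succ, pow_succ, ← ih]; ext; simp [mul_assoc]

lemma flip_exp (x : B) : (ContinuousLinearMap.mul 𝕜 B).flip (exp x) =
    exp ((ContinuousLinearMap.mul 𝕜 B).flip x) := by
  refine map_exp' _ x fun n => ?_
  induction n with
  | zero => ext; simp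
  | succ n ih => rw [pow_succ', pow_succ, ← ih]; ext; simp [mul_assoc]

end ExpFac


/-- In a unital Banach algebra over `ℝ` or `ℂ`, the Fréchet
differential of `exp` at `X` factors as
`Y ↦ exp(X/2) · τ_X(Y) · exp(X/2)` with `τ_X = ∑ (1/(2n+1)!) (ad X / 2)^{2n}`,
the series converging absolutely in operator norm. -/
theorem statement5 (𝕜 : Type*) [RCLike 𝕜] (A : Type*) [NormedRing A] [NormedAlgebra 𝕜 A]
    [CompleteSpace A] (X : A) :
    Summable (fun n : ℕ => ‖((Nat.factorial (2 * n + 1) : 𝕜))⁻¹ •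
        (((2 : 𝕜)⁻¹) • (ContinuousLinearMap.mul 𝕜 A X -
          (ContinuousLinearMap.mul 𝕜 A).flip X)) ^ (2 * n)‖) ∧
    HasFDerivAt NormedSpace.exp
      ((ContinuousLinearMap.mul 𝕜 A (NormedSpace.exp ((2 : 𝕜)⁻¹ • X))).comp
        (((ContinuousLinearMap.mul 𝕜 A).flip (NormedSpace.exp ((2 : 𝕜)⁻¹ • X))).comp
          (∑' n : ℕ, ((Nat.factorial (2 * n + 1) : 𝕜))⁻¹ •
            (((2 : 𝕜)⁻¹) • (ContinuousLinearMap.mul 𝕜 A X -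
              (ContinuousLinearMap.mul 𝕜 A).flip X)) ^ (2 * n)))) X := by
  refine ⟨ExpFac.summable_alt _, ?_⟩
  have h := ExpFac.hasFDerivAt_exp_Q 𝕜 X
  set l := ContinuousLinearMap.mul 𝕜 A X with hl
  set r := (ContinuousLinearMap.mul 𝕜 A).flip X with hr
  have hlr : Commute l r := by
    ext y
    simp [hl, hr, mul_assoc]
  have hma : Commute ((2 : 𝕜)⁻¹ • (l + r)) ((2 : 𝕜)⁻¹ • (l - r)) := by
    refine Commute.smul_left (Commute.smul_right ?_ _) _
    exact ((Commute.refl l).sub_right hlr).add_left (hlr.symm.sub_right (Commute.refl r))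
  rw [ExpFac.EQ_eq l r ((2 : 𝕜)⁻¹ • (l + r)) ((2 : 𝕜)⁻¹ • (l - r)) hma (by module) (by module) 1,
    ExpFac.EQ_alt, one_smul, smul_add,
    ExpFac.exp_add' 𝕜 ((hlr.smul_left _).smul_right _)] at h
  rw [ExpFac.mul_exp, ExpFac.flip_exp, map_smul, map_smul, ← hl, ← hr]
  exact h
end
end
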